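/- arXiv:2503.22439 — 3 statements merged into one kernel-verified Lean document; each statement's English description precedes it below -/
import Mathlib

section
/- Fix ε₁ ∈ (0, ε₃). There exists a constant C > 0, independent of the solution and of S, T, such that every classical solution of system (S) satisfies, for every 0 ≤ S ≤ T: ∫_S^T ( E_i(t) + η₁(t)² + ζ₁(t)² ) dt ≤ C ∫_S^T ∫_{1−ε₁}^{1} (u_t(t,x)² + a(x)u_x(t,x)²) dx dt + C E(S). -/
open Set MeasureTheory

/-- A classical solution of system (S): a wave equation with localized in-domain damping and
Wentzell (dynamic) boundary conditions. -/
structure ClassicalSolutionS (a q : ℝ → ℝ) (α₁ α₂ β₁ γ₁ μ₁ : ℝ) where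
  u : ℝ → ℝ → ℝ
  ut : ℝ → ℝ → ℝ
  ux : ℝ → ℝ → ℝ
  utt : ℝ → ℝ → ℝ
  dAux : ℝ → ℝ → ℝ
  η₁ : ℝ → ℝ
  η₂ : ℝ → ℝ
  ζ₁ : ℝ → ℝ
  hu_t : ∀ t ∈ Ici (0:ℝ), ∀ x ∈ Icc (0:ℝ) 1, HasDerivAt (fun s => u s x) (ut t x) t
  hu_x : ∀ t ∈ Ici (0:ℝ), ∀ x ∈ Icc (0:ℝ) 1, HasDerivAt (fun y => u t y) (ux t x) x
  hut_C1 : ContDiffOn ℝ 1 (fun p : ℝ × ℝ => ut p.1 p.2) (Ici (0:ℝ) ×ˢ Icc (0:ℝ) 1)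
  hux_C1 : ContDiffOn ℝ 1 (fun p : ℝ × ℝ => ux p.1 p.2) (Ici (0:ℝ) ×ˢ Icc (0:ℝ) 1)
  hu_tt : ∀ t ∈ Ici (0:ℝ), ∀ x ∈ Icc (0:ℝ) 1, HasDerivAt (fun s => ut s x) (utt t x) t
  haux_lip : ∀ t ∈ Ici (0:ℝ),
      ∃ K : NNReal, LipschitzOnWith K (fun x => a x * ux t x) (Icc (0:ℝ) 1)
  haux : ∀ t ∈ Ici (0:ℝ), ∀ᵐ x ∂(volume.restrict (Ioo (0:ℝ) 1)),
      HasDerivAt (fun y => a y * ux t y) (dAux t x) x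
  hPDE : ∀ t ∈ Ici (0:ℝ), ∀ᵐ x ∂(volume.restrict (Ioo (0:ℝ) 1)),
      utt t x - dAux t x = - q x * ut t x
  hbc1 : ∀ t ∈ Ici (0:ℝ), ut t 1 = η₁ t
  hbc0 : ∀ t ∈ Ici (0:ℝ), ut t 0 = ζ₁ t
  hη₁C1 : ContDiffOn ℝ 1 η₁ (Ici (0:ℝ))
  hη₂C1 : ContDiffOn ℝ 1 η₂ (Ici (0:ℝ))
  hζ₁C1 : ContDiffOn ℝ 1 ζ₁ (Ici (0:ℝ))
  hode1 : ∀ t ∈ Ici (0:ℝ), HasDerivAt η₁ (-α₁ * η₁ t - α₂ * η₂ t - β₁ * ux t 1) t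
  hode2 : ∀ t ∈ Ici (0:ℝ), HasDerivAt η₂ (η₁ t) t
  hode3 : ∀ t ∈ Ici (0:ℝ), HasDerivAt ζ₁ (-γ₁ * ζ₁ t + μ₁ * ux t 0) t

/-- The energy of a classical solution of system (S). -/
noncomputable def energyS {a q : ℝ → ℝ} {α₁ α₂ β₁ γ₁ μ₁ : ℝ}
    (sol : ClassicalSolutionS a q α₁ α₂ β₁ γ₁ μ₁) (t : ℝ) : ℝ :=
  (1/2) * (∫ x in (0:ℝ)..1, (sol.ut t x ^ 2 + a x * sol.ux t x ^ 2))
    + (a 1 / (2 * β₁)) * sol.η₁ t ^ 2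
    + (a 1 * α₂ / (2 * β₁)) * sol.η₂ t ^ 2
    + (a 0 / (2 * μ₁)) * sol.ζ₁ t ^ 2

/-- Assumption (A1): `a` is Lipschitz on `[0,1]` and bounded below and above by positive
constants `a_min ≤ a_max`. -/
def AssumptionA1 (a : ℝ → ℝ) (a_min a_max : ℝ) : Prop :=
  (∃ K : NNReal, LipschitzOnWith K a (Icc (0:ℝ) 1)) ∧ 0 < a_min ∧ a_min ≤ a_max ∧
    ∀ x ∈ Icc (0:ℝ) 1, a_min ≤ a x ∧ a x ≤ a_max

/-- Assumption (A2'): `q` is bounded measurable, nonnegative a.e., and bounded below by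
`q_min > 0` a.e. on the interval `(1-ε₃, 1)`. -/
def AssumptionA2' (q : ℝ → ℝ) (ε₃ q_min : ℝ) : Prop :=
  Measurable q ∧ (∃ Q : ℝ, ∀ x ∈ Icc (0:ℝ) 1, |q x| ≤ Q) ∧
    (∀ᵐ x ∂(volume.restrict (Ioo (0:ℝ) 1)), 0 ≤ q x) ∧
    0 < ε₃ ∧ ε₃ < 1 ∧ 0 < q_min ∧
    ∀ᵐ x ∂(volume.restrict (Ioo (1 - ε₃) 1)), q_min ≤ q x

/-- Integration in one variable of a function of two variables that is continuous on a closed half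
strip preserves continuity in the other variable. -/
lemma continuousOn_intervalIntegral_strip {g : ℝ → ℝ → ℝ} {l r : ℝ}
    (hg : ContinuousOn (fun p : ℝ × ℝ => g p.1 p.2) (Ici (0:ℝ) ×ˢ Icc (0:ℝ) 1))
    (hl : 0 ≤ l) (hlr : l ≤ r) (hr : r ≤ 1) :
    ContinuousOn (fun t => ∫ x in l..r, g t x) (Ici (0:ℝ)) := by
  set c : ℝ → ℝ := fun x => max 0 (min x 1) with hc
  have hcont : Continuous (Function.uncurry fun t x => g (max 0 t) (c x)) := by
    refine hg.comp_continuous (f := fun p : ℝ × ℝ => (max 0 p.1, c p.2)) (by fun_prop) ?_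
    intro p
    exact ⟨mem_Ici.2 (le_max_left _ _), le_max_left _ _, max_le zero_le_one (min_le_right _ _)⟩
  refine (intervalIntegral.continuous_parametric_intervalIntegral_of_continuous' hcont
    l r (μ := volume)).continuousOn.congr ?_
  intro t ht
  refine intervalIntegral.integral_congr fun x hx => ?_
  rw [uIcc_of_le hlr] at hx
  have h0 : 0 ≤ x := hl.trans hx.1
  have h1 : x ≤ 1 := hx.2.trans hr
  simp only [hc, min_eq_left h1, max_eq_right h0, max_eq_right (mem_Ici.1 ht)]

lemma continuousOn_slice {g : ℝ → ℝ → ℝ}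
    (hg : ContinuousOn (fun p : ℝ × ℝ => g p.1 p.2) (Ici (0:ℝ) ×ˢ Icc (0:ℝ) 1))
    {t : ℝ} (ht : 0 ≤ t) : ContinuousOn (g t) (Icc (0:ℝ) 1) :=
  hg.comp (f := fun x => (t, x)) (by fun_prop) fun _ hx => ⟨ht, hx⟩

/-- The increment in time of a spatial integral is the space-time integral of the time
derivative. -/
lemma integral_sub_integral_eq_integral_timeDeriv {F f : ℝ → ℝ → ℝ}
    (hF : ContinuousOn (fun p : ℝ × ℝ => F p.1 p.2) (Ici (0:ℝ) ×ˢ Icc (0:ℝ) 1))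
    (hf : ContinuousOn (fun p : ℝ × ℝ => f p.1 p.2) (Ici (0:ℝ) ×ˢ Icc (0:ℝ) 1))
    (hd : ∀ t ∈ Ici (0:ℝ), ∀ x ∈ Icc (0:ℝ) 1,
      HasDerivWithinAt (fun s => F s x) (f t x) (Ici 0) t)
    {S T : ℝ} (hS : 0 ≤ S) (hST : S ≤ T) :
    (∫ x in (0:ℝ)..1, F T x) - (∫ x in (0:ℝ)..1, F S x)
      = ∫ t in S..T, ∫ x in (0:ℝ)..1, f t x := by
  have hint : ∀ t, 0 ≤ t → IntervalIntegrable (F t) volume 0 1 := fun t ht => by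
    have := continuousOn_slice hF ht
    rw [← uIcc_of_le (zero_le_one' ℝ)] at this
    exact this.intervalIntegrable
  rw [← intervalIntegral.integral_sub (hint T (hS.trans hST)) (hint S hS),
    intervalIntegral_intervalIntegral_swap]
  · refine intervalIntegral.integral_congr fun x hx => ?_
    rw [uIcc_of_le (zero_le_one' ℝ)] at hx
    have hsub : Icc S T ⊆ Ici (0:ℝ) := fun t ht => hS.trans ht.1
    have hcf : ContinuousOn (fun t => f t x) (uIcc S T) := by
      rw [uIcc_of_le hST]
      exact hf.comp (f := fun t => (t, x)) (by fun_prop) fun t ht => ⟨hsub ht, hx⟩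
    refine (intervalIntegral.integral_eq_sub_of_hasDeriv_right_of_le (f := fun t => F t x) hST ?_ ?_
      hcf.intervalIntegrable).symm
    · exact fun t ht => (hd t (hsub ht) x hx).continuousWithinAt.mono hsub
    · intro t ht
      exact (hd t (hsub ⟨ht.1.le, ht.2.le⟩) x hx).mono
        fun s hs => (hS.trans ht.1.le).trans (le_of_lt hs)
  · rw [uIoc_of_le hST, uIoc_of_le (zero_le_one' ℝ)]
    have hK : IsCompact (Icc S T ×ˢ Icc (0:ℝ) 1) := isCompact_Icc.prod isCompact_Icc
    have : IntegrableOn (fun p : ℝ × ℝ => f p.1 p.2) (Icc S T ×ˢ Icc (0:ℝ) 1) :=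
      (hf.mono (prod_mono (fun t ht => hS.trans ht.1) subset_rfl)).integrableOn_compact hK
    exact this.mono_set (prod_mono Ioc_subset_Icc_self Ioc_subset_Icc_self)

/-- A `C¹` function on a closed half strip has a continuous (one-sided at zero) time derivative. -/
lemma exists_timeDeriv_of_contDiffOn {g : ℝ → ℝ → ℝ}
    (hg : ContDiffOn ℝ 1 (fun p : ℝ × ℝ => g p.1 p.2) (Ici (0:ℝ) ×ˢ Icc (0:ℝ) 1)) :
    ∃ gt : ℝ → ℝ → ℝ,
      ContinuousOn (fun p : ℝ × ℝ => gt p.1 p.2) (Ici (0:ℝ) ×ˢ Icc (0:ℝ) 1) ∧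
      ∀ t ∈ Ici (0:ℝ), ∀ x ∈ Icc (0:ℝ) 1,
        HasDerivWithinAt (fun s => g s x) (gt t x) (Ici 0) t := by
  set D : Set (ℝ × ℝ) := Ici (0:ℝ) ×ˢ Icc (0:ℝ) 1
  have hD : UniqueDiffOn ℝ D := (uniqueDiffOn_Ici 0).prod (uniqueDiffOn_Icc zero_lt_one)
  refine ⟨fun t x => fderivWithin ℝ (fun p : ℝ × ℝ => g p.1 p.2) D (t, x) (1, 0), ?_, ?_⟩
  · exact (hg.continuousOn_fderivWithin hD le_rfl).clm_apply continuousOn_const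
  · intro t ht x hx
    have h1 := (hg.differentiableOn one_ne_zero (t, x) ⟨ht, hx⟩).hasFDerivWithinAt
    have h2 : HasDerivWithinAt (fun s : ℝ => (s, x)) ((1:ℝ), (0:ℝ)) (Ici 0) t :=
      (hasDerivWithinAt_id t _).prodMk (hasDerivWithinAt_const _ _ _)
    exact h1.comp_hasDerivWithinAt (f := fun s : ℝ => (s, x)) t h2 (fun s hs => ⟨hs, hx⟩)

/-- Symmetry of mixed partial derivatives, for a function whose first partial derivatives are
`C¹` on a closed half strip. -/
lemma hasDerivAt_mixed_partial {u ut ux : ℝ → ℝ → ℝ}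
    (hu_t : ∀ t ∈ Ici (0:ℝ), ∀ x ∈ Icc (0:ℝ) 1, HasDerivAt (fun s => u s x) (ut t x) t)
    (hu_x : ∀ t ∈ Ici (0:ℝ), ∀ x ∈ Icc (0:ℝ) 1, HasDerivAt (fun y => u t y) (ux t x) x)
    (hut : ContDiffOn ℝ 1 (fun p : ℝ × ℝ => ut p.1 p.2) (Ici (0:ℝ) ×ˢ Icc (0:ℝ) 1))
    (hux : ContDiffOn ℝ 1 (fun p : ℝ × ℝ => ux p.1 p.2) (Ici (0:ℝ) ×ˢ Icc (0:ℝ) 1))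
    {t x r : ℝ} (ht : 0 < t) (hx : x ∈ Ioo (0:ℝ) 1)
    (hr : HasDerivAt (fun s => ux s x) r t) :
    HasDerivAt (fun y => ut t y) r x := by
  set D : Set (ℝ × ℝ) := Ici (0:ℝ) ×ˢ Icc (0:ℝ) 1
  have hnhds : ∀ p : ℝ × ℝ, 0 < p.1 → p.2 ∈ Ioo (0:ℝ) 1 → D ∈ nhds p := fun p h1 h2 =>
    prod_mem_nhds (Ici_mem_nhds h1) (Icc_mem_nhds h2.1 h2.2)
  have hopen : ∀ᶠ p : ℝ × ℝ in nhds (t, x), 0 < p.1 ∧ p.2 ∈ Ioo (0:ℝ) 1 := by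
    have : Ioi (0:ℝ) ×ˢ Ioo (0:ℝ) 1 ∈ nhds (t, x) :=
      prod_mem_nhds (Ioi_mem_nhds ht) (Ioo_mem_nhds hx.1 hx.2)
    filter_upwards [this] with p hp using ⟨hp.1, hp.2⟩
  set toL : ℝ →L[ℝ] (ℝ →L[ℝ] ℝ) :=
    (ContinuousLinearMap.toSpanSingletonCLE (𝕜 := ℝ) (E := ℝ) : ℝ →L[ℝ] (ℝ →L[ℝ] ℝ))
    with htoL
  have htoL' : ∀ c, toL c = ContinuousLinearMap.toSpanSingleton ℝ c := fun c => by
    ext; simp [htoL]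
  set A := fderiv ℝ (fun p : ℝ × ℝ => ut p.1 p.2) (t, x) with hA
  set B := fderiv ℝ (fun p : ℝ × ℝ => ux p.1 p.2) (t, x) with hB
  have hAd : HasFDerivAt (fun p : ℝ × ℝ => ut p.1 p.2) A (t, x) :=
    ((hut.contDiffAt (hnhds _ ht hx)).differentiableAt one_ne_zero).hasFDerivAt
  have hBd : HasFDerivAt (fun p : ℝ × ℝ => ux p.1 p.2) B (t, x) :=
    ((hux.contDiffAt (hnhds _ ht hx)).differentiableAt one_ne_zero).hasFDerivAt
  set f' : ℝ × ℝ → (ℝ × ℝ →L[ℝ] ℝ) := fun p =>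
    ut p.1 p.2 • ContinuousLinearMap.fst ℝ ℝ ℝ + ux p.1 p.2 • ContinuousLinearMap.snd ℝ ℝ ℝ
  have hf : ∀ᶠ p in nhds (t, x), HasFDerivAt (fun p : ℝ × ℝ => u p.1 p.2) (f' p) p := by
    filter_upwards [hopen] with p hp
    have hev : ∀ᶠ v : ℝ × ℝ in nhds p, 0 < v.1 ∧ v.2 ∈ Ioo (0:ℝ) 1 := by
      have : Ioi (0:ℝ) ×ˢ Ioo (0:ℝ) 1 ∈ nhds p :=
        prod_mem_nhds (Ioi_mem_nhds hp.1) (Ioo_mem_nhds hp.2.1 hp.2.2)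
      filter_upwards [this] with v hv using ⟨hv.1, hv.2⟩
    have key := (hasStrictFDerivAt_uncurry_coprod (𝕜 := ℝ) (u := p) (f := u)
      (f₁ := fun s y => toL (ut s y)) (f₂ := fun s y => toL (ux s y)) ?_ ?_ ?_ ?_).hasFDerivAt
    · have heq : f' p = (toL (ut p.1 p.2)).coprod (toL (ux p.1 p.2)) := by
        ext <;> simp [f', htoL']
      rw [heq]
      exact key
    · filter_upwards [hev] with v hv
      have := (hu_t v.1 hv.1.le v.2 (Ioo_subset_Icc_self hv.2)).hasFDerivAt
      simpa [htoL', Function.HasUncurry.uncurry] using this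
    · filter_upwards [hev] with v hv
      have := (hu_x v.1 hv.1.le v.2 (Ioo_subset_Icc_self hv.2)).hasFDerivAt
      simpa [htoL', Function.HasUncurry.uncurry] using this
    · exact toL.continuous.continuousAt.comp
        (hut.contDiffAt (hnhds _ hp.1 hp.2)).continuousAt
    · exact toL.continuous.continuousAt.comp
        (hux.contDiffAt (hnhds _ hp.1 hp.2)).continuousAt
  have hf'' := (hAd.smul_const (ContinuousLinearMap.fst ℝ ℝ ℝ)).add
    (hBd.smul_const (ContinuousLinearMap.snd ℝ ℝ ℝ))
  have hsymm := second_derivative_symmetric_of_eventually_of_real hf hf'' (1, 0) (0, 1)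
  simp at hsymm
  have hrB : r = B (1, 0) := by
    have h2 : HasDerivAt (fun s : ℝ => (s, x)) ((1:ℝ), (0:ℝ)) t :=
      (hasDerivAt_id t).prodMk (hasDerivAt_const _ _)
    exact hr.unique (hBd.comp_hasDerivAt (f := fun s : ℝ => (s, x)) t h2)
  have h3 : HasDerivAt (fun y : ℝ => (t, y)) ((0:ℝ), (1:ℝ)) x :=
    (hasDerivAt_const _ _).prodMk (hasDerivAt_id x)
  have := hAd.comp_hasDerivAt (f := fun y : ℝ => (t, y)) x h3
  rw [hrB, hsymm]
  exact this

/-- The boundary flux of `v * w`, minus the interior power, is the power dissipated by the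
damping `q`. -/
lemma damping_power_nonneg {a q p w z r d : ℝ → ℝ}
    (ha : ContinuousOn a (Icc (0:ℝ) 1)) (hp : ContinuousOn p (Icc (0:ℝ) 1))
    (hz : ContinuousOn z (Icc (0:ℝ) 1)) (hr : ContinuousOn r (Icc (0:ℝ) 1))
    (hq0 : ∀ᵐ x ∂(volume.restrict (Ioo (0:ℝ) 1)), 0 ≤ q x)
    (hv : AbsolutelyContinuousOnInterval (fun x => a x * p x) 0 1)
    (hw : AbsolutelyContinuousOnInterval w 0 1)
    (hwr : ∀ x ∈ Ioo (0:ℝ) 1, HasDerivAt w (r x) x)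
    (hvd : ∀ᵐ x ∂(volume.restrict (Ioo (0:ℝ) 1)), HasDerivAt (fun y => a y * p y) (d x) x)
    (hpde : ∀ᵐ x ∂(volume.restrict (Ioo (0:ℝ) 1)), z x - d x = - q x * w x) :
    0 ≤ a 1 * p 1 * w 1 - a 0 * p 0 * w 0 - ∫ x in (0:ℝ)..1, (w x * z x + a x * p x * r x) := by
  have hvw := hv.mul hw
  have h01 : uIcc (0:ℝ) 1 = Icc 0 1 := uIcc_of_le zero_le_one
  have hwc : ContinuousOn w (Icc (0:ℝ) 1) := h01 ▸ hw.continuousOn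
  have hfE : IntervalIntegrable (fun x => w x * z x + a x * p x * r x) volume 0 1 := by
    refine ContinuousOn.intervalIntegrable ?_
    rw [h01]
    fun_prop
  have hmain : 0 ≤ ∫ x in (0:ℝ)..1,
      (deriv ((fun x => a x * p x) * w) x - (w x * z x + a x * p x * r x)) := by
    refine intervalIntegral.integral_nonneg_of_ae_restrict zero_le_one ?_
    rw [Measure.restrict_congr_set Ioo_ae_eq_Icc.symm]
    filter_upwards [hq0, hvd, hpde, ae_restrict_mem measurableSet_Ioo] with x h1 h2 h3 hx
    rw [(h2.mul (hwr x hx)).deriv, show d x = z x + q x * w x by linarith]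
    have : 0 ≤ q x * w x ^ 2 := by positivity
    simp only [Pi.zero_apply]
    linarith
  rw [intervalIntegral.integral_sub hvw.intervalIntegrable_deriv hfE,
    hvw.integral_deriv_eq_sub] at hmain
  simpa using hmain

/-- The product of the damping, the velocity and the multiplier is absorbed by a quarter of the
potential energy and the power dissipated by the damping. -/
lemma damping_multiplier_lower_bound {A p w q φ m M B Q : ℝ} (hm : 0 < m) (hmA : m ≤ A)
    (hAM : A ≤ M) (hφ0 : 0 ≤ φ) (hφB : φ ≤ B) (hq0 : 0 ≤ q) (hqQ : q ≤ Q) :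
    0 ≤ m / 4 * (A * p ^ 2) + φ * (A * p) * q * w + B ^ 2 * Q * M / m * (q * w ^ 2) := by
  have hA : 0 < A := hm.trans_le hmA
  have hM : 0 < M := hA.trans_le hAM
  have h1 : A * (φ ^ 2 * q) ≤ M * (B ^ 2 * Q) := by gcongr
  have h2 : 0 ≤ (M * (B ^ 2 * Q) - A * (φ ^ 2 * q)) / m * (q * w ^ 2) :=
    mul_nonneg (div_nonneg (by linarith) hm.le) (by positivity)
  have h3 : 0 ≤ A / m * (m * p / 2 + φ * q * w) ^ 2 := by positivity
  have h4 : m / 4 * (A * p ^ 2) + φ * (A * p) * q * w + B ^ 2 * Q * M / m * (q * w ^ 2)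
      = A / m * (m * p / 2 + φ * q * w) ^ 2
        + (M * (B ^ 2 * Q) - A * (φ ^ 2 * q)) / m * (q * w ^ 2) := by
    field_simp
    ring
  linarith

/-- Coercivity of the multiplier form where the weight has large logarithmic derivative. -/
lemma multiplier_form_coercive {A A' P W E l y m K : ℝ} (hm : 0 < m) (hmA : m ≤ A) (hK : 0 ≤ K)
    (hA' : |A'| ≤ K) (hP : 0 ≤ P) (hW : 0 ≤ W) (hE : 1 ≤ E) (hy0 : 0 ≤ y) (hy1 : y ≤ 1)
    (hl : 1 + K / m ≤ l) :
    m / 2 * (W + P) ≤ E * l * (A * P) / 2 + E * (l * A + y * A') * W / 2 := by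
  obtain ⟨hK1, -⟩ := abs_le.1 hA'
  have hKm : 0 ≤ K / m := by positivity
  have hl0 : 0 ≤ l := by linarith
  have hKx : -K ≤ y * A' := by nlinarith
  have h5 : m + K ≤ l * A := by
    calc m + K = (1 + K / m) * m := by field_simp
      _ ≤ _ := by gcongr
  have h6 : m ≤ E * (l * A + y * A') := by
    have := mul_le_mul hE (show m ≤ l * A + y * A' by linarith) hm.le (by linarith)
    linarith
  have h7 : 1 ≤ E * l := one_le_mul_of_one_le_of_one_le hE (by linarith)
  have h8 : 1 * (m * P) ≤ E * l * (A * P) := by gcongr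
  have h9 := mul_le_mul_of_nonneg_right h6 hW
  linarith

/-- A crude lower bound for the multiplier form. -/
lemma multiplier_form_lower_bound {A A' P W E l y M B K : ℝ} (hA : 0 ≤ A) (hAM : A ≤ M)
    (hK : 0 ≤ K) (hA' : |A'| ≤ K) (hP : 0 ≤ P) (hW : 0 ≤ W) (hE : 0 ≤ E) (hEB : E ≤ B)
    (hy0 : 0 ≤ y) (hy1 : y ≤ 1) (hl : -1 ≤ l) :
    -(B * (M + K)) * (W + P) ≤ E * l * (A * P) / 2 + E * (l * A + y * A') * W / 2 := by
  obtain ⟨hK1, -⟩ := abs_le.1 hA'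
  have hM : 0 ≤ M := hA.trans hAM
  have hB : 0 ≤ B := hE.trans hEB
  have hKx : -K ≤ y * A' := by nlinarith
  have hlA : -M ≤ l * A := by nlinarith
  have h1 : -(E * (A * P)) ≤ E * l * (A * P) := by
    have := mul_le_mul_of_nonneg_left hl (mul_nonneg hE (mul_nonneg hA hP))
    linarith
  have h2 : E * (A * P) ≤ B * (M * P) := by gcongr
  have h3 : -(E * (M + K) * W) ≤ E * (l * A + y * A') * W := by
    have := mul_le_mul_of_nonneg_left (show -(M + K) ≤ l * A + y * A' by linarith)
      (mul_nonneg hE hW)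
    linarith
  have h4 : E * (M + K) * W ≤ B * (M + K) * W := by gcongr
  have h5 : 0 ≤ B * (M + K) * W := by positivity
  have h6 : 0 ≤ B * (M * P) := by positivity
  have h7 : 0 ≤ B * (K * P) := by positivity
  linarith

/-- The spatial multiplier inequality, at a fixed time, with a multiplier `φ` that is increasing
away from `x = 1` and vanishes at `x = 1`. -/
lemma exists_spatial_multiplier {a q : ℝ → ℝ} {m M ε Q : ℝ} {K : NNReal}
    (haK : LipschitzOnWith K a (Icc (0:ℝ) 1)) (hm : 0 < m)
    (hab : ∀ x ∈ Icc (0:ℝ) 1, m ≤ a x ∧ a x ≤ M) (hε : 0 < ε) (hε1 : ε < 1)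
    (hqQ : ∀ x ∈ Icc (0:ℝ) 1, |q x| ≤ Q)
    (hq0 : ∀ᵐ x ∂(volume.restrict (Ioo (0:ℝ) 1)), 0 ≤ q x) :
    ∃ (φ : ℝ → ℝ) (B c C₁ C₂ : ℝ), Continuous φ ∧ (∀ x ∈ Icc (0:ℝ) 1, 0 ≤ φ x ∧ φ x ≤ B) ∧
      0 < c ∧ 0 ≤ C₁ ∧ 0 ≤ C₂ ∧
      ∀ p w z r d : ℝ → ℝ, ContinuousOn p (Icc (0:ℝ) 1) → ContinuousOn z (Icc (0:ℝ) 1) →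
        ContinuousOn r (Icc (0:ℝ) 1) →
        AbsolutelyContinuousOnInterval (fun x => a x * p x) 0 1 →
        AbsolutelyContinuousOnInterval w 0 1 →
        (∀ x ∈ Ioo (0:ℝ) 1, HasDerivAt w (r x) x) →
        (∀ᵐ x ∂(volume.restrict (Ioo (0:ℝ) 1)), HasDerivAt (fun y => a y * p y) (d x) x) →
        (∀ᵐ x ∂(volume.restrict (Ioo (0:ℝ) 1)), z x - d x = - q x * w x) →
        (∫ x in (0:ℝ)..1, φ x * a x * (z x * p x + w x * r x))
          ≤ -c * (∫ x in (0:ℝ)..1, (w x ^ 2 + a x * p x ^ 2))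
            + C₁ * (∫ x in (1 - ε)..1, (w x ^ 2 + a x * p x ^ 2))
            + C₂ * (a 1 * p 1 * w 1 - a 0 * p 0 * w 0
              - ∫ x in (0:ℝ)..1, (w x * z x + a x * p x * r x)) := by
  obtain ⟨L, hL⟩ : ∃ L, L * ε = 2 + K / m := ⟨(2 + K / m) / ε, by field_simp⟩
  have hKm : (0:ℝ) ≤ K / m := by positivity
  have hL0 : 0 < L := by
    by_contra! h
    nlinarith
  have hM : 0 < M := by
    have := hab 0 (by simp)
    linarith
  have hQ : 0 ≤ Q := (abs_nonneg _).trans (hqQ 0 (by simp))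
  set B := Real.exp L with hB
  have hE : ∀ x ∈ Icc (0:ℝ) 1, 1 ≤ Real.exp (L * x) ∧ Real.exp (L * x) ≤ B := fun x hx =>
    ⟨Real.one_le_exp (mul_nonneg hL0.le hx.1), Real.exp_le_exp.2 (by nlinarith [hx.2])⟩
  set φ : ℝ → ℝ := fun x => Real.exp (L * x) * (1 - x) with hφ
  set C₂ := B ^ 2 * Q * M / m with hC₂
  have hφB : ∀ x ∈ Icc (0:ℝ) 1, 0 ≤ φ x ∧ φ x ≤ B := by
    intro x hx
    obtain ⟨h1, h2⟩ := hE x hx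
    exact ⟨mul_nonneg (by linarith) (by linarith [hx.2]), by
      simp only [hφ]; nlinarith [hx.1, hx.2]⟩
  have hφc : Continuous φ := by fun_prop
  have hφd : ∀ x, HasDerivAt φ (Real.exp (L * x) * (L * (1 - x) - 1)) x := by
    intro x
    have h1 : HasDerivAt (fun x => Real.exp (L * x)) (Real.exp (L * x) * L) x := by
      simpa using ((hasDerivAt_id x).const_mul L).exp
    convert! h1.mul ((hasDerivAt_id x).const_sub 1) using 1
    simp
    ring
  refine ⟨φ, B, m / 4, m / 2 + B * (M + K), C₂, hφc, hφB, by positivity, by positivity,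
    by positivity, ?_⟩
  intro p w z r d hp hz hr hv hw hwr hvd hpde
  have h01 : uIcc (0:ℝ) 1 = Icc 0 1 := uIcc_of_le zero_le_one
  have hac : AbsolutelyContinuousOnInterval a 0 1 :=
    LipschitzOnWith.absolutelyContinuousOnInterval (K := K) (h01.symm ▸ haK)
  have hφac : AbsolutelyContinuousOnInterval φ 0 1 :=
    ContDiffOn.absolutelyContinuousOnInterval (by
      have : ContDiff ℝ 1 φ := by fun_prop
      exact this.contDiffOn)
  have hacont : ContinuousOn a (Icc (0:ℝ) 1) := haK.continuousOn
  have hwc : ContinuousOn w (Icc (0:ℝ) 1) := h01 ▸ hw.continuousOn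
  set v : ℝ → ℝ := fun x => a x * p x with hvdef
  set G : ℝ → ℝ := φ * (v * v + a * (w * w)) with hG
  have hGac : AbsolutelyContinuousOnInterval G 0 1 :=
    hφac.mul ((hv.mul hv).add (hac.mul (hw.mul hw)))
  have hvw := hv.mul hw
  set e : ℝ → ℝ := fun x => w x ^ 2 + a x * p x ^ 2 with he
  set fE : ℝ → ℝ := fun x => w x * z x + a x * p x * r x with hfE
  set fX : ℝ → ℝ := fun x => φ x * a x * (z x * p x + w x * r x) with hfX
  have hci : ∀ f : ℝ → ℝ, ContinuousOn f (Icc (0:ℝ) 1) → IntervalIntegrable f volume 0 1 :=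
    fun f hf => ContinuousOn.intervalIntegrable (h01.symm ▸ hf)
  have hei : IntervalIntegrable e volume 0 1 := hci _ (by fun_prop)
  have hfEi : IntervalIntegrable fE volume 0 1 := hci _ (by fun_prop)
  have hfXi : IntervalIntegrable fX volume 0 1 := hci _ (by fun_prop)
  have hGi := (hGac.intervalIntegrable_deriv).const_mul (1 / 2)
  have hPi := ((hvw.intervalIntegrable_deriv).sub hfEi).const_mul C₂
  set R : ℝ → ℝ := fun x => 1 / 2 * deriv G x - fX x - m / 4 * e x
    + C₂ * (deriv (v * w) x - fE x) with hR
  have hRi : IntervalIntegrable R volume 0 1 := ((hGi.sub hfXi).sub (hei.const_mul _)).add hPi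
  have hRint : ∫ x in (0:ℝ)..1, R x = 1 / 2 * (G 1 - G 0) - (∫ x in (0:ℝ)..1, fX x)
      - m / 4 * (∫ x in (0:ℝ)..1, e x) + C₂ * (a 1 * p 1 * w 1 - a 0 * p 0 * w 0
              - ∫ x in (0:ℝ)..1, fE x) := by
    simp only [hR]
    rw [intervalIntegral.integral_add ((hGi.sub hfXi).sub (hei.const_mul _)) hPi,
      intervalIntegral.integral_sub (hGi.sub hfXi) (hei.const_mul _),
      intervalIntegral.integral_sub hGi hfXi, intervalIntegral.integral_const_mul,
      intervalIntegral.integral_const_mul, intervalIntegral.integral_const_mul,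
      intervalIntegral.integral_sub hvw.intervalIntegrable_deriv hfEi,
      hGac.integral_deriv_eq_sub, hvw.integral_deriv_eq_sub]
    simp [hvdef]
  have hae : ∀ᵐ x ∂(volume.restrict (Ioo (0:ℝ) 1)), (x ≤ 1 - ε → 0 ≤ R x) ∧
      -(m / 2 + B * (M + K)) * e x ≤ R x := by
    have had := ae_restrict_of_ae (s := Ioo (0:ℝ) 1) hac.ae_differentiableAt
    filter_upwards [hq0, hvd, hpde, had, ae_restrict_mem measurableSet_Ioo] with x h1 h2 h3 h4 hx
    have hxI := Ioo_subset_Icc_self hx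
    have h4' := (h4 (h01.symm ▸ hxI)).hasDerivAt
    have hK : |deriv a x| ≤ K := h4'.le_of_lipschitzOn (Icc_mem_nhds hx.1 hx.2) haK
    have hwx := hwr x hx
    have hGd := ((hφd x).mul ((h2.mul h2).add (h4'.mul (hwx.mul hwx)))).deriv
    have hPd := (h2.mul hwx).deriv
    obtain ⟨hm1, hM1⟩ := hab x hxI
    obtain ⟨hE1, hE2⟩ := hE x hxI
    have hyoung := damping_multiplier_lower_bound (p := p x) (w := w x) hm hm1 hM1
      (hφB x hxI).1 (hφB x hxI).2 h1 ((le_abs_self _).trans (hqQ x hxI))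
    have hRx : R x = Real.exp (L * x) * (L * (1 - x) - 1) * (a x * (a x * p x ^ 2)) / 2
        + Real.exp (L * x) * ((L * (1 - x) - 1) * a x + (1 - x) * deriv a x) * w x ^ 2 / 2
        - m / 4 * e x + (φ x * (a x * p x) * q x * w x + C₂ * (q x * w x ^ 2)) := by
      simp only [hR]
      rw [hGd, hPd, show d x = z x + q x * w x by linarith]
      simp only [hfX, hfE, hφ, hvdef, he, Pi.add_apply, Pi.mul_apply]
      ring
    have hap0 : 0 ≤ a x * p x ^ 2 := mul_nonneg (hm.le.trans hm1) (sq_nonneg _)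
    have hmP := mul_nonneg hm.le hap0
    have hmW := mul_nonneg hm.le (sq_nonneg (w x))
    have hy0 : 0 ≤ 1 - x := by linarith [hx.2]
    have hy1 : 1 - x ≤ 1 := by linarith [hx.1]
    rw [hRx]
    simp only [he]
    constructor
    · intro hxε
      have hLx : 1 + K / m ≤ L * (1 - x) - 1 := by
        have := mul_le_mul_of_nonneg_left (show ε ≤ 1 - x by linarith) hL0.le
        linarith
      have := multiplier_form_coercive hm hm1 K.coe_nonneg hK hap0 (sq_nonneg (w x)) hE1 hy0 hy1 hLx
      linarith
    · have hLx : -1 ≤ L * (1 - x) - 1 := by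
        have := mul_nonneg hL0.le hy0
        linarith
      have := multiplier_form_lower_bound (hm.le.trans hm1) hM1 K.coe_nonneg hK hap0
        (sq_nonneg (w x)) (zero_le_one.trans hE1) hE2 hy0 hy1 hLx
      linarith
  have hm0 : (0:ℝ) ≤ 1 - ε := by linarith
  have hm1 : 1 - ε ≤ (1:ℝ) := by linarith
  have hmem : 1 - ε ∈ uIcc (0:ℝ) 1 := h01.symm ▸ ⟨hm0, hm1⟩
  have hR1 : 0 ≤ ∫ x in (0:ℝ)..(1 - ε), R x := by
    refine intervalIntegral.integral_nonneg_of_ae_restrict hm0 ?_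
    rw [Measure.restrict_congr_set Ioo_ae_eq_Icc.symm]
    filter_upwards [ae_restrict_of_ae_restrict_of_subset (Ioo_subset_Ioo_right hm1) hae,
      ae_restrict_mem measurableSet_Ioo] with x h1 hx using h1.1 hx.2.le
  have hR2 : -(m / 2 + B * (M + K)) * (∫ x in (1 - ε)..1, e x) ≤ ∫ x in (1 - ε)..1, R x := by
    rw [← intervalIntegral.integral_const_mul]
    refine intervalIntegral.integral_mono_ae_restrict hm1
      ((hei.mono_set (uIcc_subset_uIcc hmem right_mem_uIcc)).const_mul _)
      (hRi.mono_set (uIcc_subset_uIcc hmem right_mem_uIcc)) ?_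
    rw [Measure.restrict_congr_set Ioo_ae_eq_Icc.symm]
    filter_upwards [ae_restrict_of_ae_restrict_of_subset (Ioo_subset_Ioo_left hm0) hae]
      with x h1 using h1.2
  have hsplit := intervalIntegral.integral_add_adjacent_intervals
    (hRi.mono_set (uIcc_subset_uIcc left_mem_uIcc hmem))
    (hRi.mono_set (uIcc_subset_uIcc hmem right_mem_uIcc))
  have hG1 : G 1 = 0 := by simp [hG, hφ]
  have hG0 : 0 ≤ G 0 := by
    have : 0 < a 0 := hm.trans_le (hab 0 (by simp)).1
    simp only [hG, Pi.mul_apply, Pi.add_apply]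
    exact mul_nonneg (hφB 0 (by simp)).1
      (add_nonneg (mul_self_nonneg _) (mul_nonneg this.le (mul_self_nonneg _)))
  linarith

namespace ClassicalSolutionS

variable {a q : ℝ → ℝ} {α₁ α₂ β₁ γ₁ μ₁ : ℝ}

lemma continuousOn_utt (sol : ClassicalSolutionS a q α₁ α₂ β₁ γ₁ μ₁) :
    ContinuousOn (fun p : ℝ × ℝ => sol.utt p.1 p.2) (Ici (0:ℝ) ×ˢ Icc (0:ℝ) 1) := by
  obtain ⟨z, hz, hzd⟩ := exists_timeDeriv_of_contDiffOn sol.hut_C1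
  refine hz.congr fun p hp => ?_
  exact (uniqueDiffOn_Ici (0:ℝ) p.1 hp.1).eq_deriv _
    (sol.hu_tt p.1 hp.1 p.2 hp.2).hasDerivWithinAt (hzd p.1 hp.1 p.2 hp.2)

lemma exists_mixed_partial (sol : ClassicalSolutionS a q α₁ α₂ β₁ γ₁ μ₁) :
    ∃ r : ℝ → ℝ → ℝ,
      ContinuousOn (fun p : ℝ × ℝ => r p.1 p.2) (Ici (0:ℝ) ×ˢ Icc (0:ℝ) 1) ∧
      (∀ t ∈ Ici (0:ℝ), ∀ x ∈ Icc (0:ℝ) 1,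
        HasDerivWithinAt (fun s => sol.ux s x) (r t x) (Ici 0) t) ∧
      ∀ t ∈ Ioi (0:ℝ), ∀ x ∈ Ioo (0:ℝ) 1, HasDerivAt (sol.ut t) (r t x) x := by
  obtain ⟨r, hr, hrd⟩ := exists_timeDeriv_of_contDiffOn sol.hux_C1
  refine ⟨r, hr, hrd, fun t ht x hx => ?_⟩
  exact hasDerivAt_mixed_partial sol.hu_t sol.hu_x sol.hut_C1 sol.hux_C1 ht hx
    ((hrd t (mem_Ioi.1 ht).le x (Ioo_subset_Icc_self hx)).hasDerivAt (Ici_mem_nhds ht))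

lemma absolutelyContinuous_ut (sol : ClassicalSolutionS a q α₁ α₂ β₁ γ₁ μ₁) {t : ℝ} (ht : 0 ≤ t) :
    AbsolutelyContinuousOnInterval (sol.ut t) 0 1 := by
  refine ContDiffOn.absolutelyContinuousOnInterval ?_
  rw [uIcc_of_le (zero_le_one' ℝ)]
  exact sol.hut_C1.comp (f := fun x => (t, x)) (by fun_prop) fun x hx => ⟨ht, hx⟩

lemma absolutelyContinuous_flux (sol : ClassicalSolutionS a q α₁ α₂ β₁ γ₁ μ₁) {t : ℝ}
    (ht : 0 ≤ t) : AbsolutelyContinuousOnInterval (fun x => a x * sol.ux t x) 0 1 := by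
  obtain ⟨K, hK⟩ := sol.haux_lip t ht
  rw [← uIcc_of_le (zero_le_one' ℝ)] at hK
  exact hK.absolutelyContinuousOnInterval

lemma energyS_dissipation (sol : ClassicalSolutionS a q α₁ α₂ β₁ γ₁ μ₁)
    (ha : ContinuousOn a (Icc (0:ℝ) 1)) (hβ₁ : 0 < β₁) (hμ₁ : 0 < μ₁) {r : ℝ → ℝ → ℝ}
    (hr : ContinuousOn (fun p : ℝ × ℝ => r p.1 p.2) (Ici (0:ℝ) ×ˢ Icc (0:ℝ) 1))
    (hrd : ∀ t ∈ Ici (0:ℝ), ∀ x ∈ Icc (0:ℝ) 1,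
        HasDerivWithinAt (fun s => sol.ux s x) (r t x) (Ici 0) t)
    {S T : ℝ} (hS : 0 ≤ S) (hST : S ≤ T) :
    energyS sol T + α₁ * a 1 / β₁ * (∫ t in S..T, sol.η₁ t ^ 2)
      + γ₁ * a 0 / μ₁ * (∫ t in S..T, sol.ζ₁ t ^ 2)
      + (∫ t in S..T, (a 1 * sol.ux t 1 * sol.ut t 1 - a 0 * sol.ux t 0 * sol.ut t 0
          - ∫ x in (0:ℝ)..1, (sol.ut t x * sol.utt t x + a x * sol.ux t x * r t x)))
      = energyS sol S := by
  have hsub : uIcc S T ⊆ Ici (0:ℝ) := by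
    rw [uIcc_of_le hST]
    exact fun t ht => hS.trans ht.1
  have hut := sol.hut_C1.continuousOn
  have hux := sol.hux_C1.continuousOn
  have hutt := sol.continuousOn_utt
  have ha' : ContinuousOn (fun p : ℝ × ℝ => a p.2) (Ici (0:ℝ) ×ˢ Icc (0:ℝ) 1) :=
    ha.comp continuousOn_snd fun p hp => hp.2
  have hf : ContinuousOn (fun p : ℝ × ℝ => sol.ut p.1 p.2 * sol.utt p.1 p.2
      + a p.2 * sol.ux p.1 p.2 * r p.1 p.2) (Ici (0:ℝ) ×ˢ Icc (0:ℝ) 1) :=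
    (hut.mul hutt).add ((ha'.mul hux).mul hr)
  have hinterior := integral_sub_integral_eq_integral_timeDeriv
    (F := fun t x => 1 / 2 * (sol.ut t x ^ 2 + a x * sol.ux t x ^ 2))
    (f := fun t x => sol.ut t x * sol.utt t x + a x * sol.ux t x * r t x)
    (continuousOn_const.mul ((hut.pow 2).add (ha'.mul (hux.pow 2)))) hf
    (fun t ht x hx => by
      have h1 := (sol.hu_tt t ht x hx).hasDerivWithinAt (s := Ici 0)
      refine (((h1.pow 2).add (((hrd t ht x hx).pow 2).const_mul (a x))).const_mul
        (1 / 2)).congr_deriv ?_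
      simp
      ring) hS hST
  simp only [intervalIntegral.integral_const_mul] at hinterior
  have hslice : ∀ y ∈ Icc (0:ℝ) 1, ContinuousOn (fun t => sol.ux t y) (uIcc S T) := fun y hy =>
    hux.comp (f := fun t => (t, y)) (by fun_prop) fun t ht => ⟨hsub ht, hy⟩
  have hslice' : ∀ y ∈ Icc (0:ℝ) 1, ContinuousOn (fun t => sol.ut t y) (uIcc S T) := fun y hy =>
    hut.comp (f := fun t => (t, y)) (by fun_prop) fun t ht => ⟨hsub ht, hy⟩
  have hx1 := hslice 1 (by simp)
  have hx0 := hslice 0 (by simp)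
  have ht1 := hslice' 1 (by simp)
  have ht0 := hslice' 0 (by simp)
  have hη := sol.hη₁C1.continuousOn.mono hsub
  have hζ := sol.hζ₁C1.continuousOn.mono hsub
  have hI := (continuousOn_intervalIntegral_strip
    (g := fun t x => sol.ut t x * sol.utt t x + a x * sol.ux t x * r t x) hf
      le_rfl zero_le_one le_rfl).mono hsub
  have hflux : IntervalIntegrable
      (fun t => a 1 * sol.ux t 1 * sol.ut t 1 - a 0 * sol.ux t 0 * sol.ut t 0) volume S T :=
    ContinuousOn.intervalIntegrable (by fun_prop)
  have hη2 : IntervalIntegrable (fun t => sol.η₁ t ^ 2) volume S T :=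
    ContinuousOn.intervalIntegrable (by fun_prop)
  have hζ2 : IntervalIntegrable (fun t => sol.ζ₁ t ^ 2) volume S T :=
    ContinuousOn.intervalIntegrable (by fun_prop)
  have hbd := intervalIntegral.integral_eq_sub_of_hasDerivAt (a := S) (b := T)
    (f := fun t => (a 1 / (2 * β₁)) * sol.η₁ t ^ 2 + (a 1 * α₂ / (2 * β₁)) * sol.η₂ t ^ 2
      + (a 0 / (2 * μ₁)) * sol.ζ₁ t ^ 2)
    (f' := fun t => -(α₁ * a 1 / β₁) * sol.η₁ t ^ 2 + -(γ₁ * a 0 / μ₁) * sol.ζ₁ t ^ 2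
      - (a 1 * sol.ux t 1 * sol.ut t 1 - a 0 * sol.ux t 0 * sol.ut t 0))
    (fun t ht => by
      have h0 := hsub ht
      refine ((((sol.hode1 t h0).pow 2).const_mul (a 1 / (2 * β₁))).add
        (((sol.hode2 t h0).pow 2).const_mul (a 1 * α₂ / (2 * β₁))) |>.add
        (((sol.hode3 t h0).pow 2).const_mul (a 0 / (2 * μ₁)))).congr_deriv ?_
      rw [sol.hbc1 t h0, sol.hbc0 t h0]
      simp
      field_simp
      ring)
    (((hη2.const_mul _).add (hζ2.const_mul _)).sub hflux)
  rw [intervalIntegral.integral_sub ((hη2.const_mul _).add (hζ2.const_mul _)) hflux,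
    intervalIntegral.integral_add (hη2.const_mul _) (hζ2.const_mul _),
    intervalIntegral.integral_const_mul, intervalIntegral.integral_const_mul] at hbd
  rw [intervalIntegral.integral_sub hflux hI.intervalIntegrable]
  unfold energyS
  linarith

end ClassicalSolutionS

/-- First multiplier estimate (Lemma 3.1): the interior energy plus the boundary damping terms,
integrated in time, are controlled by the localized energy near `x = 1` and `E(S)`. -/
theorem multiplier_estimate_S0 (a q : ℝ → ℝ)
    (a_min a_max ε₁ ε₃ q_min α₁ α₂ β₁ γ₁ μ₁ : ℝ)
    (hA1 : AssumptionA1 a a_min a_max) (hA2 : AssumptionA2' q ε₃ q_min)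
    (hε₁ : 0 < ε₁) (hε₁₃ : ε₁ < ε₃)
    (hα₁ : 0 < α₁) (hα₂ : 0 < α₂) (hβ₁ : 0 < β₁) (hγ₁ : 0 < γ₁) (hμ₁ : 0 < μ₁) :
    ∃ C > (0:ℝ), ∀ sol : ClassicalSolutionS a q α₁ α₂ β₁ γ₁ μ₁, ∀ S T : ℝ, 0 ≤ S → S ≤ T →
      (∫ t in S..T,
          ((1/2) * (∫ x in (0:ℝ)..1, (sol.ut t x ^ 2 + a x * sol.ux t x ^ 2))
            + sol.η₁ t ^ 2 + sol.ζ₁ t ^ 2))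
        ≤ C * (∫ t in S..T, ∫ x in (1 - ε₁)..1, (sol.ut t x ^ 2 + a x * sol.ux t x ^ 2))
          + C * energyS sol S := by
  obtain ⟨⟨K, haK⟩, hm, hmM, hab⟩ := hA1
  obtain ⟨-, ⟨Q, hqQ⟩, hq0, -, hε₃1, -, -⟩ := hA2
  obtain ⟨φ, B, c, C₁, C₂, hφc, hφB, hc, hC₁, hC₂, hmult⟩ :=
    exists_spatial_multiplier haK hm hab hε₁ (hε₁₃.trans hε₃1) hqQ hq0
  have hacont : ContinuousOn a (Icc (0:ℝ) 1) := haK.continuousOn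
  have ha1 : 0 < a 1 := hm.trans_le (hab 1 (by simp)).1
  have ha0 : 0 < a 0 := hm.trans_le (hab 0 (by simp)).1
  have hB : 0 ≤ B := (hφB 0 (by simp)).1.trans (hφB 0 (by simp)).2
  have hM : 0 ≤ a_max := (hm.trans_le hmM).le
  set κ₁ := α₁ * a 1 / β₁ with hκ₁
  set κ₀ := γ₁ * a 0 / μ₁ with hκ₀
  have hκ₁pos : 0 < κ₁ := by positivity
  have hκ₀pos : 0 < κ₀ := by positivity
  set C₃ := B * (a_max + 1) with hC₃
  have hC₃0 : 0 ≤ C₃ := by positivity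
  refine ⟨C₁ / (2 * c) + (C₂ + 2 * C₃) / (2 * c) + 1 / κ₁ + 1 / κ₀, by positivity, ?_⟩
  intro sol S T hS hST
  obtain ⟨r, hr, hrd, hrx⟩ := sol.exists_mixed_partial
  have hε₁1 : (0:ℝ) ≤ 1 - ε₁ := by linarith
  have hsub : uIcc S T ⊆ Ici (0:ℝ) := by
    rw [uIcc_of_le hST]
    exact fun t ht => hS.trans ht.1
  have hut := sol.hut_C1.continuousOn
  have hux := sol.hux_C1.continuousOn
  have hutt := sol.continuousOn_utt
  have ha' : ContinuousOn (fun p : ℝ × ℝ => a p.2) (Ici (0:ℝ) ×ˢ Icc (0:ℝ) 1) :=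
    hacont.comp continuousOn_snd fun p hp => hp.2
  set e : ℝ → ℝ → ℝ := fun t x => sol.ut t x ^ 2 + a x * sol.ux t x ^ 2 with he
  set fE : ℝ → ℝ → ℝ := fun t x => sol.ut t x * sol.utt t x + a x * sol.ux t x * r t x with hfE
  set FX : ℝ → ℝ → ℝ := fun t x => φ x * a x * (sol.ut t x * sol.ux t x) with hFX
  set fX : ℝ → ℝ → ℝ :=
    fun t x => φ x * a x * (sol.utt t x * sol.ux t x + sol.ut t x * r t x) with hfX
  have hφ' : ContinuousOn (fun p : ℝ × ℝ => φ p.2) (Ici (0:ℝ) ×ˢ Icc (0:ℝ) 1) :=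
    (hφc.comp continuous_snd).continuousOn
  have hec : ContinuousOn (fun p : ℝ × ℝ => e p.1 p.2) (Ici (0:ℝ) ×ˢ Icc (0:ℝ) 1) :=
    (hut.pow 2).add (ha'.mul (hux.pow 2))
  have hfEc : ContinuousOn (fun p : ℝ × ℝ => fE p.1 p.2) (Ici (0:ℝ) ×ˢ Icc (0:ℝ) 1) :=
    (hut.mul hutt).add ((ha'.mul hux).mul hr)
  have hFXc : ContinuousOn (fun p : ℝ × ℝ => FX p.1 p.2) (Ici (0:ℝ) ×ˢ Icc (0:ℝ) 1) :=
    (hφ'.mul ha').mul (hut.mul hux)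
  have hfXc : ContinuousOn (fun p : ℝ × ℝ => fX p.1 p.2) (Ici (0:ℝ) ×ˢ Icc (0:ℝ) 1) :=
    (hφ'.mul ha').mul ((hutt.mul hux).add (hut.mul hr))
  have he0 : ∀ t, ∀ x ∈ Icc (0:ℝ) 1, 0 ≤ e t x := fun t x hx => by
    have := hm.trans_le (hab x hx).1
    positivity
  have hint : ∀ g : ℝ → ℝ → ℝ,
      ContinuousOn (fun p : ℝ × ℝ => g p.1 p.2) (Ici (0:ℝ) ×ˢ Icc (0:ℝ) 1) →
      ∀ l, 0 ≤ l → l ≤ 1 →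
        IntervalIntegrable (fun t => ∫ x in l..1, g t x) volume S T := fun g hg l h0 h1 =>
    ((continuousOn_intervalIntegral_strip hg h0 h1 le_rfl).mono hsub).intervalIntegrable
  have hslice : ∀ y ∈ Icc (0:ℝ) 1, ContinuousOn (fun t => sol.ux t y) (uIcc S T) := fun y hy =>
    hux.comp (f := fun t => (t, y)) (by fun_prop) fun t ht => ⟨hsub ht, hy⟩
  have hslice' : ∀ y ∈ Icc (0:ℝ) 1, ContinuousOn (fun t => sol.ut t y) (uIcc S T) := fun y hy =>
    hut.comp (f := fun t => (t, y)) (by fun_prop) fun t ht => ⟨hsub ht, hy⟩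
  have hx1 := hslice 1 (by simp)
  have hx0 := hslice 0 (by simp)
  have ht1 := hslice' 1 (by simp)
  have ht0 := hslice' 0 (by simp)
  have hη := sol.hη₁C1.continuousOn.mono hsub
  have hζ := sol.hζ₁C1.continuousOn.mono hsub
  have hη2 : IntervalIntegrable (fun t => sol.η₁ t ^ 2) volume S T :=
    ContinuousOn.intervalIntegrable (by fun_prop)
  have hζ2 : IntervalIntegrable (fun t => sol.ζ₁ t ^ 2) volume S T :=
    ContinuousOn.intervalIntegrable (by fun_prop)
  set P : ℝ → ℝ := fun t => a 1 * sol.ux t 1 * sol.ut t 1 - a 0 * sol.ux t 0 * sol.ut t 0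
    - ∫ x in (0:ℝ)..1, fE t x with hP
  have hPi : IntervalIntegrable P volume S T :=
    (ContinuousOn.intervalIntegrable (by fun_prop)).sub (hint fE hfEc 0 le_rfl zero_le_one)
  have hei := hint e hec 0 le_rfl zero_le_one
  have hωi := hint e hec (1 - ε₁) hε₁1 (by linarith)
  have hP0 : 0 ≤ ∫ t in S..T, P t := by
    refine intervalIntegral.integral_nonneg_of_ae_restrict hST ?_
    rw [Measure.restrict_congr_set Ioo_ae_eq_Icc.symm]
    filter_upwards [ae_restrict_mem measurableSet_Ioo] with t ht
    have h0 : 0 < t := hS.trans_lt ht.1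
    exact damping_power_nonneg hacont (continuousOn_slice hux h0.le)
      (continuousOn_slice hutt h0.le) (continuousOn_slice hr h0.le) hq0
      (sol.absolutelyContinuous_flux h0.le) (sol.absolutelyContinuous_ut h0.le) (hrx t h0)
      (sol.haux t h0.le) (sol.hPDE t h0.le)
  have henergy := sol.energyS_dissipation hacont hβ₁ hμ₁ hr hrd hS hST
  have hη0 : 0 ≤ ∫ t in S..T, sol.η₁ t ^ 2 :=
    intervalIntegral.integral_nonneg hST fun _ _ => sq_nonneg _
  have hζ0 : 0 ≤ ∫ t in S..T, sol.ζ₁ t ^ 2 :=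
    intervalIntegral.integral_nonneg hST fun _ _ => sq_nonneg _
  have hE : ∀ t, (1 / 2) * (∫ x in (0:ℝ)..1, e t x) ≤ energyS sol t := by
    intro t
    have : 0 ≤ (a 1 / (2 * β₁)) * sol.η₁ t ^ 2 + (a 1 * α₂ / (2 * β₁)) * sol.η₂ t ^ 2
      + (a 0 / (2 * μ₁)) * sol.ζ₁ t ^ 2 := by positivity
    unfold energyS
    linarith
  have hint0 : ∀ t, 0 ≤ ∫ x in (0:ℝ)..1, e t x := fun t =>
    intervalIntegral.integral_nonneg zero_le_one (he0 t)
  have hES0 : 0 ≤ energyS sol S := by linarith [hE S, hint0 S]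
  have hET0 : 0 ≤ energyS sol T := by linarith [hE T, hint0 T]
  have hκη := mul_nonneg hκ₁pos.le hη0
  have hκζ := mul_nonneg hκ₀pos.le hζ0
  have hXbound : ∀ t, 0 ≤ t → |∫ x in (0:ℝ)..1, FX t x| ≤ C₃ * energyS sol t := by
    intro t ht
    have h01 : uIcc (0:ℝ) 1 = Icc 0 1 := uIcc_of_le zero_le_one
    have hei' : IntervalIntegrable (e t) volume 0 1 :=
      ContinuousOn.intervalIntegrable (h01.symm ▸ continuousOn_slice hec ht)
    have h1 : |∫ x in (0:ℝ)..1, FX t x| ≤ ∫ x in (0:ℝ)..1, C₃ * (1 / 2) * e t x := by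
      rw [← Real.norm_eq_abs]
      refine intervalIntegral.norm_integral_le_of_norm_le zero_le_one (.of_forall ?_)
        (hei'.const_mul _)
      intro x hx
      have hxI := Ioc_subset_Icc_self hx
      obtain ⟨h1, h2⟩ := hφB x hxI
      obtain ⟨h3, h4⟩ := hab x hxI
      have h5 : 0 < a x := hm.trans_le h3
      have h6 : |sol.ut t x * sol.ux t x| ≤ (sol.ut t x ^ 2 + sol.ux t x ^ 2) / 2 :=
        abs_le.2 ⟨by nlinarith [sq_nonneg (sol.ut t x + sol.ux t x)],
          by nlinarith [sq_nonneg (sol.ut t x - sol.ux t x)]⟩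
      rw [Real.norm_eq_abs, hFX, abs_mul, abs_of_nonneg (mul_nonneg h1 h5.le)]
      calc φ x * a x * |sol.ut t x * sol.ux t x|
          ≤ B * a x * ((sol.ut t x ^ 2 + sol.ux t x ^ 2) / 2) := by gcongr
        _ = B * (a x * sol.ut t x ^ 2 + a x * sol.ux t x ^ 2) / 2 := by ring
        _ ≤ B * ((a_max + 1) * sol.ut t x ^ 2 + (a_max + 1) * (a x * sol.ux t x ^ 2)) / 2 := by
          have h7 : a x ≤ a_max + 1 := by linarith
          have h8 : a x * sol.ux t x ^ 2 ≤ (a_max + 1) * (a x * sol.ux t x ^ 2) :=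
            le_mul_of_one_le_left (by positivity) (by linarith)
          gcongr
        _ = C₃ * (1 / 2) * e t x := by simp only [hC₃, he]; ring
    rw [intervalIntegral.integral_const_mul] at h1
    have := mul_le_mul_of_nonneg_left (hE t) hC₃0
    linarith
  have hX := integral_sub_integral_eq_integral_timeDeriv hFXc hfXc
    (fun t ht x hx => by
      refine (((sol.hu_tt t ht x hx).hasDerivWithinAt.mul (hrd t ht x hx)).const_mul
        (φ x * a x)).congr_deriv rfl) hS hST
  have hXle : (∫ t in S..T, ∫ x in (0:ℝ)..1, fX t x)
      ≤ ∫ t in S..T, (-c * (∫ x in (0:ℝ)..1, e t x) + C₁ * (∫ x in (1 - ε₁)..1, e t x)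
          + C₂ * P t) := by
    refine intervalIntegral.integral_mono_on_of_le_Ioo hST (hint fX hfXc 0 le_rfl zero_le_one)
      (((hei.const_mul _).add (hωi.const_mul _)).add (hPi.const_mul _)) ?_
    intro t ht
    have h0 : 0 < t := hS.trans_lt ht.1
    exact hmult (sol.ux t) (sol.ut t) (sol.utt t) (r t) (sol.dAux t) (continuousOn_slice hux h0.le)
      (continuousOn_slice hutt h0.le) (continuousOn_slice hr h0.le)
      (sol.absolutelyContinuous_flux h0.le) (sol.absolutelyContinuous_ut h0.le) (hrx t h0)
      (sol.haux t h0.le) (sol.hPDE t h0.le)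
  rw [intervalIntegral.integral_add ((hei.const_mul _).add (hωi.const_mul _)) (hPi.const_mul _),
    intervalIntegral.integral_add (hei.const_mul _) (hωi.const_mul _),
    intervalIntegral.integral_const_mul, intervalIntegral.integral_const_mul,
    intervalIntegral.integral_const_mul] at hXle
  rw [intervalIntegral.integral_add ((hei.const_mul _).add hη2) hζ2,
    intervalIntegral.integral_add (hei.const_mul _) hη2, intervalIntegral.integral_const_mul]
  set ES := energyS sol S
  set W := ∫ t in S..T, ∫ x in (1 - ε₁)..1, e t x with hW
  set I := ∫ t in S..T, ∫ x in (0:ℝ)..1, e t x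
  have hW0 : 0 ≤ W := intervalIntegral.integral_nonneg hST fun t _ =>
    intervalIntegral.integral_nonneg (by linarith) fun x hx => he0 t x ⟨hε₁1.trans hx.1, hx.2⟩
  have hbP : C₂ * (∫ t in S..T, P t) ≤ C₂ * ES :=
    mul_le_mul_of_nonneg_left (by linarith) hC₂
  have hbT : C₃ * energyS sol T ≤ C₃ * ES := mul_le_mul_of_nonneg_left (by linarith) hC₃0
  have hXS := (abs_le.1 (hXbound S hS)).2
  have hXT := (abs_le.1 (hXbound T (hS.trans hST))).1
  have hI : 1 / 2 * I ≤ C₁ / (2 * c) * W + (C₂ + 2 * C₃) / (2 * c) * ES := by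
    have : c * I ≤ C₁ * W + (C₂ + 2 * C₃) * ES := by linarith
    calc 1 / 2 * I = c * I / (2 * c) := by field_simp
      _ ≤ (C₁ * W + (C₂ + 2 * C₃) * ES) / (2 * c) := by gcongr
      _ = _ := by ring
  have hη3 : (∫ t in S..T, sol.η₁ t ^ 2) ≤ 1 / κ₁ * ES := by
    rw [one_div_mul_eq_div, le_div_iff₀ hκ₁pos]
    linarith
  have hζ3 : (∫ t in S..T, sol.ζ₁ t ^ 2) ≤ 1 / κ₀ * ES := by
    rw [one_div_mul_eq_div, le_div_iff₀ hκ₀pos]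
    linarith
  have hr1 : 0 ≤ ((C₂ + 2 * C₃) / (2 * c) + 1 / κ₁ + 1 / κ₀) * W := by positivity
  have hr2 : 0 ≤ C₁ / (2 * c) * ES := by positivity
  linarith
end

section
/- There exists a constant C > 0, independent of t and of the solution, with the following property. For every classical solution of system (S), every t ≥ 0, and every function v : [0,1] → ℝ which is C¹ with x ↦ a(x)v'(x) locally Lipschitz and which satisfies ∂_x(a(x)v'(x)) = φ(x)(u(t,x) − u_*) for a.e. x ∈ (0,1), v'(0) = 0 and v'(1) + (α₂/β₁)v(1) = 0, one has: v(0)² + v(1)² ≤ C E(t) and ∫₀¹ v(x)² dx ≤ C E(t). -/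
open Set MeasureTheory

/-- A Lipschitz function whose derivative is a.e. bounded by `W` on `(0,1)` moves by at most `W`. -/
theorem abs_sub_le_of_lipschitzOnWith_of_ae_hasDerivAt {p d : ℝ → ℝ} {K : NNReal} {W : ℝ}
    (hp : LipschitzOnWith K p (Icc (0:ℝ) 1))
    (hd : ∀ᵐ x ∂(volume.restrict (Ioo (0:ℝ) 1)), HasDerivAt p (d x) x ∧ |d x| ≤ W)
    (hW : 0 ≤ W) {x : ℝ} (hx : x ∈ Icc (0:ℝ) 1) : |p x - p 0| ≤ W := by
  have hac : AbsolutelyContinuousOnInterval p 0 x := by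
    refine LipschitzOnWith.absolutelyContinuousOnInterval (K := K) (hp.mono ?_)
    rw [uIcc_of_le hx.1]
    exact Icc_subset_Icc_right hx.2
  rw [ae_restrict_iff' measurableSet_Ioo] at hd
  have hne : ∀ᵐ y ∂(volume : Measure ℝ), y ≠ 1 := by
    simp [ae_iff, measure_singleton]
  have hbound : ‖∫ y in (0:ℝ)..x, deriv p y‖ ≤ W * |x - 0| := by
    refine intervalIntegral.norm_integral_le_of_norm_le_const_ae ?_
    filter_upwards [hd, hne] with y hy hy1 hyx
    rw [uIoc_of_le hx.1] at hyx
    obtain ⟨hder, hle⟩ := hy ⟨hyx.1, lt_of_le_of_ne (hyx.2.trans hx.2) hy1⟩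
    rwa [hder.deriv, Real.norm_eq_abs]
  rw [hac.integral_deriv_eq_sub, Real.norm_eq_abs, sub_zero, abs_of_nonneg hx.1] at hbound
  exact hbound.trans (mul_le_of_le_one_right hW hx.2)

/-- The Cauchy–Schwarz inequality on `[0,1]` against the constant function. -/
theorem sq_integral_abs_le_integral_sq {f : ℝ → ℝ} (hf : ContinuousOn f (Icc (0:ℝ) 1)) :
    (∫ x in (0:ℝ)..1, |f x|) ^ 2 ≤ ∫ x in (0:ℝ)..1, f x ^ 2 := by
  rw [← uIcc_of_le zero_le_one] at hf
  have h1 : IntervalIntegrable (fun x => |f x|) volume 0 1 := hf.abs.intervalIntegrable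
  have h2 : IntervalIntegrable (fun x => f x ^ 2) volume 0 1 := (hf.pow 2).intervalIntegrable
  set m := ∫ x in (0:ℝ)..1, |f x| with hm
  have h0 : 0 ≤ ∫ x in (0:ℝ)..1, (|f x| - m) ^ 2 :=
    intervalIntegral.integral_nonneg zero_le_one fun x _ => sq_nonneg _
  have heq : (∫ x in (0:ℝ)..1, (|f x| - m) ^ 2) = (∫ x in (0:ℝ)..1, f x ^ 2) - m ^ 2 := by
    have hexp : (fun x => (|f x| - m) ^ 2) = fun x => f x ^ 2 - 2 * m * |f x| + m ^ 2 := by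
      funext x
      rw [sub_sq, sq_abs]
      ring
    rw [hexp, intervalIntegral.integral_add (h2.sub (h1.const_mul _)) intervalIntegrable_const,
      intervalIntegral.integral_sub h2 (h1.const_mul _), intervalIntegral.integral_const_mul,
      intervalIntegral.integral_const, ← hm]
    simp only [smul_eq_mul]
    ring
  linarith

namespace ClassicalSolutionS

variable {a q : ℝ → ℝ} {α₁ α₂ β₁ γ₁ μ₁ : ℝ}

/-- The quantity `u(t,1) - η₂(t)` is conserved. -/
theorem u_one_sub_η₂_eq (sol : ClassicalSolutionS a q α₁ α₂ β₁ γ₁ μ₁) {t : ℝ} (ht : 0 ≤ t) :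
    sol.u t 1 - sol.η₂ t = sol.u 0 1 - sol.η₂ 0 := by
  have hder : ∀ s ∈ Ici (0:ℝ), HasDerivAt (fun s => sol.u s 1 - sol.η₂ s) 0 s := by
    intro s hs
    have h := (sol.hu_t s hs 1 (right_mem_Icc.2 zero_le_one)).sub (sol.hode2 s hs)
    rwa [sol.hbc1 s hs, sub_self] at h
  exact constant_of_has_deriv_right_zero
    (fun s hs => (hder s hs.1).continuousAt.continuousWithinAt)
    (fun s hs => (hder s hs.1).hasDerivWithinAt) t (right_mem_Icc.2 ht)

theorem continuousOn_ut (sol : ClassicalSolutionS a q α₁ α₂ β₁ γ₁ μ₁) {t : ℝ} (ht : 0 ≤ t) :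
    ContinuousOn (sol.ut t) (Icc (0:ℝ) 1) :=
  sol.hut_C1.continuousOn.comp (f := fun x : ℝ => (t, x)) (by fun_prop) fun _ hx => ⟨ht, hx⟩

theorem continuousOn_ux (sol : ClassicalSolutionS a q α₁ α₂ β₁ γ₁ μ₁) {t : ℝ} (ht : 0 ≤ t) :
    ContinuousOn (sol.ux t) (Icc (0:ℝ) 1) :=
  sol.hux_C1.continuousOn.comp (f := fun x : ℝ => (t, x)) (by fun_prop) fun _ hx => ⟨ht, hx⟩

theorem abs_displacement_le (sol : ClassicalSolutionS a q α₁ α₂ β₁ γ₁ μ₁) {t x : ℝ} (ht : 0 ≤ t)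
    (hx : x ∈ Icc (0:ℝ) 1) :
    |sol.u t x - (sol.u 0 1 - sol.η₂ 0)| ≤ |sol.η₂ t| + ∫ y in (0:ℝ)..1, |sol.ux t y| := by
  have hsub : uIcc x 1 ⊆ Icc (0:ℝ) 1 := by
    rw [uIcc_of_le hx.2]
    exact Icc_subset_Icc_left hx.1
  have hcont := sol.continuousOn_ux ht
  have hftc : ∫ y in x..1, sol.ux t y = sol.u t 1 - sol.u t x :=
    intervalIntegral.integral_eq_sub_of_hasDerivAt (fun y hy => sol.hu_x t ht y (hsub hy))
      (hcont.mono hsub).intervalIntegrable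
  have hint : |∫ y in x..1, sol.ux t y| ≤ ∫ y in (0:ℝ)..1, |sol.ux t y| := by
    refine (intervalIntegral.abs_integral_le_integral_abs hx.2).trans ?_
    refine intervalIntegral.integral_mono_interval hx.1 hx.2 le_rfl
      (Filter.Eventually.of_forall fun y => abs_nonneg _) ?_
    rw [← uIcc_of_le zero_le_one] at hcont
    exact hcont.abs.intervalIntegrable
  have heq : sol.u t x - (sol.u 0 1 - sol.η₂ 0) = sol.η₂ t - ∫ y in x..1, sol.ux t y := by
    rw [hftc, ← sol.u_one_sub_η₂_eq ht]
    ring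
  rw [heq]
  exact (abs_sub _ _).trans (by linarith)

/-- The energy controls the square of the pointwise bound on the displacement. -/
theorem sq_displacement_bound_le_energyS {a_min a_max : ℝ} (hA1 : AssumptionA1 a a_min a_max)
    (hα₂ : 0 < α₂) (hβ₁ : 0 < β₁) (hμ₁ : 0 < μ₁)
    (sol : ClassicalSolutionS a q α₁ α₂ β₁ γ₁ μ₁) {t : ℝ} (ht : 0 ≤ t) :
    (|sol.η₂ t| + ∫ y in (0:ℝ)..1, |sol.ux t y|) ^ 2
      ≤ 4 / a_min * (β₁ / α₂ + 1) * energyS sol t := by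
  obtain ⟨⟨K, hK⟩, hmin, -, ha⟩ := hA1
  have ha0 := (ha 0 (left_mem_Icc.2 zero_le_one)).1
  have ha1 := (ha 1 (right_mem_Icc.2 zero_le_one)).1
  have hux := sol.continuousOn_ux ht
  have hut := sol.continuousOn_ut ht
  have hcs := sq_integral_abs_le_integral_sq hux
  have hkin : a_min * ∫ y in (0:ℝ)..1, sol.ux t y ^ 2
      ≤ ∫ y in (0:ℝ)..1, (sol.ut t y ^ 2 + a y * sol.ux t y ^ 2) := by
    rw [← intervalIntegral.integral_const_mul]
    refine intervalIntegral.integral_mono_on zero_le_one ?_ ?_ fun y hy => ?_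
    · refine ContinuousOn.intervalIntegrable ?_
      rw [uIcc_of_le zero_le_one]
      exact continuousOn_const.mul (hux.pow 2)
    · refine ContinuousOn.intervalIntegrable ?_
      rw [uIcc_of_le zero_le_one]
      exact (hut.pow 2).add (hK.continuousOn.mul (hux.pow 2))
    · have := mul_le_mul_of_nonneg_right (ha y hy).1 (sq_nonneg (sol.ux t y))
      nlinarith [sq_nonneg (sol.ut t y)]
  set m := ∫ y in (0:ℝ)..1, |sol.ux t y|
  set S := ∫ y in (0:ℝ)..1, sol.ux t y ^ 2
  have hS : 0 ≤ S := (sq_nonneg m).trans hcs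
  have h1 : 0 ≤ a 1 / (2 * β₁) * sol.η₁ t ^ 2 := by
    have : 0 < a 1 := hmin.trans_le ha1
    positivity
  have h0 : 0 ≤ a 0 / (2 * μ₁) * sol.ζ₁ t ^ 2 := by
    have : 0 < a 0 := hmin.trans_le ha0
    positivity
  have h2 : a_min * α₂ / (2 * β₁) * sol.η₂ t ^ 2 ≤ a 1 * α₂ / (2 * β₁) * sol.η₂ t ^ 2 := by
    gcongr
  have hE : a_min / 2 * S + a_min * α₂ / (2 * β₁) * sol.η₂ t ^ 2 ≤ energyS sol t := by
    unfold energyS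
    linarith
  have hsq : (|sol.η₂ t| + m) ^ 2 ≤ 2 * sol.η₂ t ^ 2 + 2 * S := by
    nlinarith [sq_nonneg (|sol.η₂ t| - m), sq_abs (sol.η₂ t)]
  calc (|sol.η₂ t| + m) ^ 2 ≤ 2 * sol.η₂ t ^ 2 + 2 * S := hsq
    _ ≤ 2 * sol.η₂ t ^ 2 + 2 * S + (2 * (β₁ / α₂) * S + 2 * (α₂ / β₁) * sol.η₂ t ^ 2) :=
        le_add_of_nonneg_right (by positivity)
    _ = 4 / a_min * (β₁ / α₂ + 1)
          * (a_min / 2 * S + a_min * α₂ / (2 * β₁) * sol.η₂ t ^ 2) := by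
        field_simp
        ring
    _ ≤ 4 / a_min * (β₁ / α₂ + 1) * energyS sol t := by gcongr

end ClassicalSolutionS

/-- Estimates for the auxiliary elliptic multiplier `v` solving `(a v')' = φ (u(t,·) - u_*)` with
boundary conditions `v'(0) = 0` and `v'(1) + (α₂/β₁) v(1) = 0`:
`v(0)² + v(1)² ≤ C E(t)` and `∫₀¹ v² ≤ C E(t)`. -/
theorem elliptic_multiplier_estimates_v (a q φ : ℝ → ℝ)
    (a_min a_max ε₂ ε₃ q_min α₁ α₂ β₁ γ₁ μ₁ : ℝ)
    (hA1 : AssumptionA1 a a_min a_max) (hA2 : AssumptionA2' q ε₃ q_min)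
    (hε₂ : 0 < ε₂) (hε₂₃ : ε₂ < ε₃)
    (hα₁ : 0 < α₁) (hα₂ : 0 < α₂) (hβ₁ : 0 < β₁) (hγ₁ : 0 < γ₁) (hμ₁ : 0 < μ₁)
    (hφ : ContDiff ℝ (⊤ : ℕ∞) φ) (hφ01 : ∀ x, φ x ∈ Icc (0:ℝ) 1)
    (hφ1 : ∀ x ∈ Ioc (1 - ε₂) (1:ℝ), φ x = 1) (hφ0 : ∀ x ∈ Icc (0:ℝ) (1 - ε₃), φ x = 0) :
    ∃ C > (0:ℝ), ∀ sol : ClassicalSolutionS a q α₁ α₂ β₁ γ₁ μ₁, ∀ t ∈ Ici (0:ℝ),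
      ∀ v v' dv : ℝ → ℝ,
        (∀ x ∈ Icc (0:ℝ) 1, HasDerivAt v (v' x) x) → ContinuousOn v' (Icc (0:ℝ) 1) →
        (∃ K : NNReal, LipschitzOnWith K (fun x => a x * v' x) (Icc (0:ℝ) 1)) →
        (∀ᵐ x ∂(volume.restrict (Ioo (0:ℝ) 1)),
          HasDerivAt (fun y => a y * v' y) (dv x) x ∧
            dv x = φ x * (sol.u t x - (sol.u 0 1 - sol.η₂ 0))) →
        v' 0 = 0 → v' 1 + (α₂ / β₁) * v 1 = 0 →
        v 0 ^ 2 + v 1 ^ 2 ≤ C * energyS sol t ∧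
          (∫ x in (0:ℝ)..1, v x ^ 2) ≤ C * energyS sol t := by
  set L := (1 + β₁ / α₂) / a_min with hL
  obtain ⟨hmin, ha⟩ : 0 < a_min ∧ ∀ x ∈ Icc (0:ℝ) 1, a_min ≤ a x :=
    ⟨hA1.2.1, fun x hx => (hA1.2.2.2 x hx).1⟩
  refine ⟨2 * L ^ 2 * (4 / a_min * (β₁ / α₂ + 1)), by positivity, ?_⟩
  rintro sol t ht v v' dv hv hv'c ⟨K, hK⟩ hdv hv'0 hv'1
  have h01 : (0:ℝ) ∈ Icc (0:ℝ) 1 := left_mem_Icc.2 zero_le_one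
  have h11 : (1:ℝ) ∈ Icc (0:ℝ) 1 := right_mem_Icc.2 zero_le_one
  have hWE := sol.sq_displacement_bound_le_energyS hA1 hα₂ hβ₁ hμ₁ ht
  set W := |sol.η₂ t| + ∫ y in (0:ℝ)..1, |sol.ux t y| with hWdef
  have hW : 0 ≤ W := (abs_nonneg _).trans (sol.abs_displacement_le ht h01)
  have hflux : ∀ x ∈ Icc (0:ℝ) 1, |a x * v' x| ≤ W := by
    intro x hx
    have hbound : ∀ᵐ x ∂(volume.restrict (Ioo (0:ℝ) 1)),
        HasDerivAt (fun y => a y * v' y) (dv x) x ∧ |dv x| ≤ W := by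
      filter_upwards [hdv, ae_restrict_mem measurableSet_Ioo] with y hy hyI
      refine ⟨hy.1, ?_⟩
      rw [hy.2, abs_mul, abs_of_nonneg (hφ01 y).1]
      exact (mul_le_of_le_one_left (abs_nonneg _) (hφ01 y).2).trans
        (sol.abs_displacement_le ht (Ioo_subset_Icc_self hyI))
    simpa [hv'0] using abs_sub_le_of_lipschitzOnWith_of_ae_hasDerivAt hK hbound hW hx
  have hv'b : ∀ x ∈ Icc (0:ℝ) 1, |v' x| ≤ W / a_min := by
    intro x hx
    rw [le_div_iff₀ hmin, mul_comm]
    have h := hflux x hx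
    rw [abs_mul, abs_of_pos (hmin.trans_le (ha x hx))] at h
    exact (mul_le_mul_of_nonneg_right (ha x hx) (abs_nonneg _)).trans h
  have hv1 : |v 1| ≤ β₁ / α₂ * (W / a_min) := by
    have h : v 1 = -(β₁ / α₂) * v' 1 := by
      rw [eq_neg_of_add_eq_zero_left hv'1]
      field_simp
    rw [h, abs_mul, abs_neg, abs_of_pos (by positivity)]
    gcongr
    exact hv'b 1 h11
  have hvb : ∀ x ∈ Icc (0:ℝ) 1, v x ^ 2 ≤ L ^ 2 * W ^ 2 := by
    intro x hx
    have hmv : ‖v 1 - v x‖ ≤ W / a_min * ‖1 - x‖ :=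
      (convex_Icc (0:ℝ) 1).norm_image_sub_le_of_norm_hasDerivWithin_le
        (fun y hy => (hv y hy).hasDerivWithinAt) hv'b hx h11
    rw [Real.norm_eq_abs, Real.norm_eq_abs, abs_of_nonneg (sub_nonneg.2 hx.2)] at hmv
    have hstep : |v 1 - v x| ≤ W / a_min :=
      hmv.trans (mul_le_of_le_one_right (by positivity) (by linarith [hx.1]))
    have htri : |v x| ≤ |v 1| + |v 1 - v x| := by
      simpa using abs_sub (v 1) (v 1 - v x)
    have habs : |v x| ≤ L * W := by
      calc |v x| ≤ β₁ / α₂ * (W / a_min) + W / a_min := by linarith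
        _ = L * W := by rw [hL]; ring
    rw [← mul_pow, ← sq_abs]
    gcongr
  have hfinal : 2 * (L ^ 2 * W ^ 2)
      ≤ 2 * L ^ 2 * (4 / a_min * (β₁ / α₂ + 1)) * energyS sol t := by
    rw [mul_assoc (2 * L ^ 2), ← mul_assoc 2]
    gcongr
  refine ⟨by linarith [hvb 0 h01, hvb 1 h11], ?_⟩
  have hint : ∫ x in (0:ℝ)..1, v x ^ 2 ≤ ∫ _ in (0:ℝ)..1, L ^ 2 * W ^ 2 := by
    refine intervalIntegral.integral_mono_on zero_le_one ?_ intervalIntegrable_const hvb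
    refine ContinuousOn.intervalIntegrable ?_
    rw [uIcc_of_le zero_le_one]
    exact fun x hx => ((hv x hx).continuousAt.pow 2).continuousWithinAt
  rw [intervalIntegral.integral_const, sub_zero, one_smul] at hint
  have : 0 ≤ L ^ 2 * W ^ 2 := by positivity
  linarith
end

section
/- There exists a constant C > 0, independent of t and of the solution, with the following property. For every classical solution of system (S), every t ≥ 0, and every function w : [0,1] → ℝ which is C¹ with x ↦ a(x)w'(x) locally Lipschitz and which satisfies ∂_x(a(x)w'(x)) = φ(x)u_t(t,x) for a.e. x ∈ (0,1), w'(0) = 0 and w'(1) + (α₂/β₁)w(1) = 0, one has: w(0)² + w(1)² ≤ C ∫₀¹ q(x) u_t(t,x)² dx and ∫₀¹ w(x)² dx ≤ C ∫₀¹ q(x) u_t(t,x)² dx. -/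
open Set MeasureTheory

/-- Cauchy–Schwarz for the primitive of a continuous function on the unit interval. -/
lemma sq_integral_le_integral_sq {h : ℝ → ℝ} (hh : ContinuousOn h (Icc 0 1)) {x : ℝ}
    (hx : x ∈ Icc (0 : ℝ) 1) :
    (∫ y in (0 : ℝ)..x, h y) ^ 2 ≤ ∫ y in (0 : ℝ)..1, h y ^ 2 := by
  have hint : IntervalIntegrable h volume 0 x :=
    (hh.mono (Icc_subset_Icc_right hx.2)).intervalIntegrable_of_Icc hx.1
  have hint2 : IntervalIntegrable (fun y => h y ^ 2) volume 0 1 :=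
    (hh.pow 2).intervalIntegrable_of_Icc zero_le_one
  have hint2x : IntervalIntegrable (fun y => h y ^ 2) volume 0 x :=
    ((hh.pow 2).mono (Icc_subset_Icc_right hx.2)).intervalIntegrable_of_Icc hx.1
  have hmono : ∫ y in (0 : ℝ)..x, h y ^ 2 ≤ ∫ y in (0 : ℝ)..1, h y ^ 2 :=
    intervalIntegral.integral_mono_interval le_rfl hx.1 hx.2
      (ae_of_all _ fun y => sq_nonneg (h y)) hint2
  set c := ∫ y in (0 : ℝ)..x, h y with hc
  have hnonneg : 0 ≤ ∫ y in (0 : ℝ)..x, (h y - c) ^ 2 :=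
    intervalIntegral.integral_nonneg hx.1 fun y _ => sq_nonneg _
  have hexpand : ∫ y in (0 : ℝ)..x, (h y - c) ^ 2
      = (∫ y in (0 : ℝ)..x, h y ^ 2) - 2 * c * c + x * c ^ 2 := by
    have : ∀ y, (h y - c) ^ 2 = h y ^ 2 - 2 * c * h y + c ^ 2 := fun y => by ring
    simp_rw [this]
    rw [intervalIntegral.integral_add (hint2x.sub (hint.const_mul _)) intervalIntegrable_const,
      intervalIntegral.integral_sub hint2x (hint.const_mul _),
      intervalIntegral.integral_const_mul, intervalIntegral.integral_const, ← hc]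
    simp
  nlinarith [mul_nonneg (sub_nonneg.2 hx.2) (sq_nonneg c)]

/-- A Lipschitz function on the unit interval is the primitive of its a.e. derivative. -/
lemma LipschitzOnWith.integral_eq_sub_of_ae_hasDerivAt {g h : ℝ → ℝ} {K : NNReal}
    (hg : LipschitzOnWith K g (Icc 0 1))
    (hd : ∀ᵐ x ∂(volume.restrict (Ioo (0 : ℝ) 1)), HasDerivAt g (h x) x) {x : ℝ}
    (hx : x ∈ Icc (0 : ℝ) 1) :
    ∫ y in (0 : ℝ)..x, h y = g x - g 0 := by
  have hsub : uIcc 0 x ⊆ Icc (0 : ℝ) 1 := by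
    rw [uIcc_of_le hx.1]
    exact Icc_subset_Icc_right hx.2
  rw [← (hg.mono hsub).absolutelyContinuousOnInterval.integral_deriv_eq_sub]
  apply intervalIntegral.integral_congr_ae
  filter_upwards [(ae_restrict_iff' measurableSet_Ioo).1 hd, volume.ae_ne (1 : ℝ)]
    with y hy hy1 hyx
  rw [uIoc_of_le hx.1] at hyx
  exact (hy ⟨hyx.1, lt_of_le_of_ne (hyx.2.trans hx.2) hy1⟩).deriv.symm

/-- A cutoff supported where the damping `q` is bounded below is controlled by `q` in `L²`. -/
lemma integral_sq_cutoff_mul_le {q φ v : ℝ → ℝ} {ε₃ q_min : ℝ} (hq : AssumptionA2' q ε₃ q_min)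
    (hφ : Continuous φ) (hφ01 : ∀ x, φ x ∈ Icc (0 : ℝ) 1)
    (hφ0 : ∀ x ∈ Icc (0 : ℝ) (1 - ε₃), φ x = 0) (hv : ContinuousOn v (Icc 0 1)) :
    ∫ x in (0 : ℝ)..1, (φ x * v x) ^ 2 ≤ (∫ x in (0 : ℝ)..1, q x * v x ^ 2) / q_min := by
  obtain ⟨hmeas, ⟨Q, hQ⟩, hq0, hε0, hε1, hqm, hqlow⟩ := hq
  have hv2 : ContinuousOn (fun x => v x ^ 2) (Icc 0 1) := hv.pow 2
  have hint : IntervalIntegrable (fun x => q x * v x ^ 2) volume 0 1 := by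
    rw [intervalIntegrable_iff_integrableOn_Icc_of_le zero_le_one]
    exact (hv2.integrableOn_Icc).bdd_mul hmeas.aestronglyMeasurable
      (ae_restrict_of_forall_mem measurableSet_Icc hQ)
  have hintl : IntervalIntegrable (fun x => (φ x * v x) ^ 2) volume 0 1 :=
    ((hφ.continuousOn.mul hv).pow 2).intervalIntegrable_of_Icc zero_le_one
  rw [← intervalIntegral.integral_div]
  apply intervalIntegral.integral_mono_ae_restrict zero_le_one hintl (hint.div_const _)
  rw [Filter.EventuallyLE, ae_restrict_iff' measurableSet_Icc]
  filter_upwards [(ae_restrict_iff' measurableSet_Ioo).1 hq0,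
    (ae_restrict_iff' measurableSet_Ioo).1 hqlow, volume.ae_ne (1 : ℝ), volume.ae_ne (0 : ℝ)]
    with x hx0 hxlow hx1 hx0' hx
  have hxIoo : x ∈ Ioo (0 : ℝ) 1 := ⟨lt_of_le_of_ne hx.1 hx0'.symm, lt_of_le_of_ne hx.2 hx1⟩
  rcases le_or_gt x (1 - ε₃) with hle | hlt
  · rw [hφ0 x ⟨hx.1, hle⟩]
    have := mul_nonneg (hx0 hxIoo) (sq_nonneg (v x))
    simp only [zero_mul, ne_eq, OfNat.ofNat_ne_zero, not_false_eq_true, zero_pow]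
    positivity
  · rw [le_div_iff₀ hqm, mul_pow]
    have h1 : φ x ^ 2 ≤ 1 := pow_le_one₀ (hφ01 x).1 (hφ01 x).2
    have h2 := hxlow ⟨hlt, hxIoo.2⟩
    calc φ x ^ 2 * v x ^ 2 * q_min ≤ 1 * v x ^ 2 * q_min := by gcongr
      _ = q_min * v x ^ 2 := by ring
      _ ≤ q x * v x ^ 2 := by gcongr

lemma ClassicalSolutionS.continuousOn_ut_s9 {a q : ℝ → ℝ} {α₁ α₂ β₁ γ₁ μ₁ : ℝ}
    (sol : ClassicalSolutionS a q α₁ α₂ β₁ γ₁ μ₁) {t : ℝ} (ht : t ∈ Ici (0 : ℝ)) :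
    ContinuousOn (sol.ut t) (Icc 0 1) :=
  sol.hut_C1.continuousOn.comp (f := fun x : ℝ => (t, x)) (by fun_prop) fun _ hx => ⟨ht, hx⟩

/-- A function on the unit interval with derivative bounded by `S` and a Robin condition at `1`
is bounded in terms of `S`. -/
lemma abs_le_of_abs_deriv_le_of_robin {w w' : ℝ → ℝ} {α β S : ℝ} (hα : 0 < α) (hβ : 0 < β)
    (hw : ∀ x ∈ Icc (0 : ℝ) 1, HasDerivAt w (w' x) x)
    (hS : ∀ x ∈ Icc (0 : ℝ) 1, |w' x| ≤ S) (hrobin : w' 1 + α / β * w 1 = 0) {x : ℝ}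
    (hx : x ∈ Icc (0 : ℝ) 1) : |w x| ≤ (β / α + 1) * S := by
  have h1 : (1 : ℝ) ∈ Icc (0 : ℝ) 1 := right_mem_Icc.2 zero_le_one
  have hS0 : 0 ≤ S := (abs_nonneg _).trans (hS 1 h1)
  have hmv : |w x - w 1| ≤ S * |x - 1| :=
    Convex.norm_image_sub_le_of_norm_hasDerivWithin_le
      (fun y hy => (hw y hy).hasDerivWithinAt) hS (convex_Icc 0 1) h1 hx
  have hx1 : |x - 1| ≤ 1 := abs_le.2 ⟨by linarith [hx.1], by linarith [hx.2]⟩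
  have hw1 : w 1 = -(β / α * w' 1) := by
    field_simp at hrobin ⊢
    linarith
  have hw1' : |w 1| ≤ β / α * S := by
    rw [hw1, abs_neg, abs_mul, abs_of_pos (div_pos hβ hα)]
    exact mul_le_mul_of_nonneg_left (hS 1 h1) (by positivity)
  calc |w x| = |(w x - w 1) + w 1| := by ring_nf
    _ ≤ |w x - w 1| + |w 1| := abs_add_le _ _
    _ ≤ S * 1 + β / α * S := by
      gcongr
      exact hmv.trans (mul_le_mul_of_nonneg_left hx1 hS0)
    _ = (β / α + 1) * S := by ring

/-- Estimates for the auxiliary elliptic multiplier `w` solving `(a w')' = φ uₜ(t,·)` with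
boundary conditions `w'(0) = 0` and `w'(1) + (α₂/β₁) w(1) = 0`:
`w(0)² + w(1)² ≤ C ∫₀¹ q uₜ²` and `∫₀¹ w² ≤ C ∫₀¹ q uₜ²`. -/
theorem elliptic_multiplier_estimates_vt (a q φ : ℝ → ℝ)
    (a_min a_max ε₂ ε₃ q_min α₁ α₂ β₁ γ₁ μ₁ : ℝ)
    (hA1 : AssumptionA1 a a_min a_max) (hA2 : AssumptionA2' q ε₃ q_min)
    (hε₂ : 0 < ε₂) (hε₂₃ : ε₂ < ε₃)
    (hα₁ : 0 < α₁) (hα₂ : 0 < α₂) (hβ₁ : 0 < β₁) (hγ₁ : 0 < γ₁) (hμ₁ : 0 < μ₁)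
    (hφ : ContDiff ℝ (⊤ : ℕ∞) φ) (hφ01 : ∀ x, φ x ∈ Icc (0:ℝ) 1)
    (hφ1 : ∀ x ∈ Ioc (1 - ε₂) (1:ℝ), φ x = 1) (hφ0 : ∀ x ∈ Icc (0:ℝ) (1 - ε₃), φ x = 0) :
    ∃ C > (0:ℝ), ∀ sol : ClassicalSolutionS a q α₁ α₂ β₁ γ₁ μ₁, ∀ t ∈ Ici (0:ℝ),
      ∀ w w' dw : ℝ → ℝ,
        (∀ x ∈ Icc (0:ℝ) 1, HasDerivAt w (w' x) x) → ContinuousOn w' (Icc (0:ℝ) 1) →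
        (∃ K : NNReal, LipschitzOnWith K (fun x => a x * w' x) (Icc (0:ℝ) 1)) →
        (∀ᵐ x ∂(volume.restrict (Ioo (0:ℝ) 1)),
          HasDerivAt (fun y => a y * w' y) (dw x) x ∧ dw x = φ x * sol.ut t x) →
        w' 0 = 0 → w' 1 + (α₂ / β₁) * w 1 = 0 →
        w 0 ^ 2 + w 1 ^ 2 ≤ C * (∫ x in (0:ℝ)..1, q x * sol.ut t x ^ 2) ∧
          (∫ x in (0:ℝ)..1, w x ^ 2) ≤ C * (∫ x in (0:ℝ)..1, q x * sol.ut t x ^ 2) := by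
  have ha0 : 0 < a_min := hA1.2.1
  have hqm : 0 < q_min := hA2.2.2.2.2.2.1
  set B : ℝ := (β₁ / α₂ + 1) ^ 2 / (a_min ^ 2 * q_min) with hB
  have hBpos : 0 < B := by positivity
  refine ⟨2 * B, by positivity, ?_⟩
  intro sol t ht w w' dw hw hw'c hLip hdw hw0 hrobin
  obtain ⟨K, hK⟩ := hLip
  set I : ℝ := ∫ x in (0 : ℝ)..1, q x * sol.ut t x ^ 2
  have hut := sol.continuousOn_ut_s9 ht
  have hflux : ∀ x ∈ Icc (0 : ℝ) 1, (a x * w' x) ^ 2 ≤ I / q_min := by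
    intro x hx
    have hprim := hK.integral_eq_sub_of_ae_hasDerivAt
      (hdw.mono fun y hy => hy.2 ▸ hy.1) hx
    rw [hw0, mul_zero, sub_zero] at hprim
    rw [← hprim]
    exact (sq_integral_le_integral_sq (hφ.continuous.continuousOn.mul hut) hx).trans
      (integral_sq_cutoff_mul_le hA2 hφ.continuous hφ01 hφ0 hut)
  have hI : 0 ≤ I / q_min := (sq_nonneg _).trans (hflux 0 (left_mem_Icc.2 zero_le_one))
  have hI0 : 0 ≤ I := by simpa [hqm.ne'] using mul_nonneg hI hqm.le
  have hS : ∀ x ∈ Icc (0 : ℝ) 1, |w' x| ≤ √(I / q_min) / a_min := by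
    intro x hx
    rw [le_div_iff₀ ha0]
    have hax := (hA1.2.2.2 x hx).1
    calc |w' x| * a_min ≤ |w' x| * a x := by gcongr
      _ = |a x * w' x| := by rw [abs_mul, abs_of_pos (ha0.trans_le hax), mul_comm]
      _ ≤ √(I / q_min) := Real.abs_le_sqrt (hflux x hx)
  have hbound : ∀ x ∈ Icc (0 : ℝ) 1, w x ^ 2 ≤ B * I := by
    intro x hx
    have h := abs_le_of_abs_deriv_le_of_robin hα₂ hβ₁ hw hS hrobin hx
    calc w x ^ 2 = |w x| ^ 2 := (sq_abs _).symm
      _ ≤ ((β₁ / α₂ + 1) * (√(I / q_min) / a_min)) ^ 2 := by gcongr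
      _ = B * I := by
        rw [mul_pow, div_pow, Real.sq_sqrt hI, hB]
        field_simp
  constructor
  · linarith [hbound 0 (left_mem_Icc.2 zero_le_one), hbound 1 (right_mem_Icc.2 zero_le_one)]
  · have hwc : ContinuousOn w (Icc 0 1) := fun x hx => (hw x hx).continuousAt.continuousWithinAt
    calc ∫ x in (0 : ℝ)..1, w x ^ 2 ≤ ∫ _ in (0 : ℝ)..1, B * I :=
          intervalIntegral.integral_mono_on zero_le_one
            ((hwc.pow 2).intervalIntegrable_of_Icc zero_le_one) intervalIntegrable_const hbound
      _ = B * I := by simp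
      _ ≤ 2 * B * I := by nlinarith [mul_nonneg hBpos.le hI0]
end
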